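/- arXiv:1312.6757 — 2 statements merged into one kernel-verified Lean document; each statement's English description precedes it below -/
import Mathlib

section
/- Let n ≥ 2, μ ∈ ℝ, σ > 0, η > 0, and let N^n_{(μ,σ)} be the n-fold product on ℝⁿ of the normal distribution N(μ,σ²). Then N^n_{(μ,σ)}({x ∈ ℝⁿ : σ²·e^{−2η} ≤ S̄(x)/n ≤ σ²·e^{2η}}) = ∫_{n·e^{−2η}}^{n·e^{2η}} p^{χ²}_{n−1}(x) dx. In particular this probability depends only on n and η, not on (μ,σ). -/
open MeasureTheory ProbabilityTheory

/-- The chi-squared density with `m` degrees of freedom. -/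
noncomputable def chiSqPDF (m : ℕ) (x : ℝ) : ℝ :=
  x ^ ((m : ℝ) / 2 - 1) * Real.exp (-x / 2) /
    (2 ^ ((m : ℝ) / 2) * Real.Gamma ((m : ℝ) / 2))

lemma pi_gaussian_eq_withDensity (m : ℕ) :
    (Measure.pi fun _ : Fin m => gaussianReal 0 1) =
      (volume : Measure (Fin m → ℝ)).withDensity
        (fun x => ENNReal.ofReal (∏ i, gaussianPDFReal 0 1 (x i))) := by
  refine Measure.pi_eq fun s hs => ?_
  rw [withDensity_apply _ (MeasurableSet.univ_pi hs), volume_pi, Measure.restrict_pi_pi,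
    ← ofReal_integral_eq_lintegral_ofReal]
  · rw [integral_fintype_prod_eq_prod (f := fun _ x => gaussianPDFReal 0 1 x),
      ENNReal.ofReal_prod_of_nonneg]
    · refine Finset.prod_congr rfl fun i _ => ?_
      rw [gaussianReal_apply_eq_integral _ one_ne_zero]
    · intro i _
      exact integral_nonneg (gaussianPDFReal_nonneg _ _)
  · exact Integrable.fintype_prod (f := fun _ x => gaussianPDFReal 0 1 x)
      fun i => (integrable_gaussianPDFReal _ _).restrict
  · exact ae_of_all _ fun x => Finset.prod_nonneg fun i _ => gaussianPDFReal_nonneg _ _ _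

lemma prod_gaussianPDF (m : ℕ) (x : Fin m → ℝ) :
    ∏ i, gaussianPDFReal 0 1 (x i) =
      (√(2 * Real.pi))⁻¹ ^ m * Real.exp (-(∑ i, x i ^ 2) / 2) := by
  simp only [gaussianPDFReal_def, Finset.prod_mul_distrib, ← Real.exp_sum]
  simp [neg_div, Finset.sum_div]

lemma chi_const (m : ℕ) (hm : 1 ≤ m) (r : ℝ) (hr : 0 < r) :
    (m : ℝ) * ((√Real.pi ^ m / Real.Gamma (m / 2 + 1)) * (r ^ (m - 1) *
      ((√(2 * Real.pi))⁻¹ ^ m * Real.exp (-(r ^ 2) / 2)))) =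
    2 * r * chiSqPDF m (r ^ 2) := by
  have hm0 : (0 : ℝ) < m := by exact_mod_cast hm
  unfold chiSqPDF
  have hG : 0 < Real.Gamma ((m : ℝ) / 2) := Real.Gamma_pos_of_pos (by positivity)
  rw [Real.Gamma_add_one (by positivity)]
  have h1 : (2 : ℝ) ^ ((m : ℝ) / 2) = √2 ^ m := by
    rw [Real.sqrt_eq_rpow, ← Real.rpow_natCast, ← Real.rpow_mul (by norm_num)]
    congr 1; ring
  have h2 : (r ^ 2) ^ ((m : ℝ) / 2 - 1) = r ^ (m - 1) / r := by
    rw [← Real.rpow_natCast r 2, ← Real.rpow_mul hr.le, ← Real.rpow_natCast r (m - 1),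
      ← Real.rpow_sub_one hr.ne']
    congr 1
    push_cast [hm]; ring
  have hpi : 0 < √Real.pi := Real.sqrt_pos.2 Real.pi_pos
  rw [h1, h2, Real.sqrt_mul (by norm_num), mul_inv, mul_pow, inv_pow, inv_pow]
  have : (0:ℝ) < √2 := by positivity
  field_simp

lemma chi_band (m : ℕ) (hm : 1 ≤ m) (a b : ℝ) (ha : 0 < a) (hab : a ≤ b) :
    (Measure.pi fun _ : Fin m => gaussianReal 0 1)
      {y : Fin m → ℝ | a ≤ ∑ i, y i ^ 2 ∧ ∑ i, y i ^ 2 ≤ b} =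
    ENNReal.ofReal (∫ t in a..b, chiSqPDF m t) := by
  have : Nonempty (Fin m) := ⟨⟨0, hm⟩⟩
  have hS : MeasurableSet {y : Fin m → ℝ | a ≤ ∑ i, y i ^ 2 ∧ ∑ i, y i ^ 2 ≤ b} := by
    have : Measurable fun y : Fin m → ℝ => ∑ i, y i ^ 2 := by fun_prop
    exact this measurableSet_Icc
  rw [pi_gaussian_eq_withDensity, withDensity_apply _ hS, ← ofReal_integral_eq_lintegral_ofReal]
  rotate_left
  · exact (Integrable.fintype_prod (f := fun _ x => gaussianPDFReal 0 1 x)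
      fun i => integrable_gaussianPDFReal _ _).restrict
  · exact ae_of_all _ fun x => Finset.prod_nonneg fun i _ => gaussianPDFReal_nonneg _ _ _
  congr 1
  set f : ℝ → ℝ := fun r => (Set.Icc a b).indicator
    (fun t => (√(2 * Real.pi))⁻¹ ^ m * Real.exp (-t / 2)) (r ^ 2) with hf
  have e1 : ∫ y in {y : Fin m → ℝ | a ≤ ∑ i, y i ^ 2 ∧ ∑ i, y i ^ 2 ≤ b},
      ∏ i, gaussianPDFReal 0 1 (y i) = ∫ y : EuclideanSpace ℝ (Fin m), f ‖y‖ := by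
    rw [← integral_indicator hS, ← (PiLp.volume_preserving_toLp (Fin m)).integral_comp
      (MeasurableEquiv.toLp 2 _).measurableEmbedding]
    congr 1
    ext y
    simp only [hf, EuclideanSpace.real_norm_sq_eq, Set.indicator, Set.mem_ofPred_eq, Set.mem_Icc,
      prod_gaussianPDF]
  rw [e1, integral_fun_norm_addHaar, intervalIntegral.integral_of_le hab,
    ← integral_Icc_eq_integral_Ioc]
  have e2 : ∫ t in Set.Icc a b, chiSqPDF m t =
      ∫ t in Set.Ioi (0 : ℝ), (Set.Icc a b).indicator (chiSqPDF m) t := by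
    rw [setIntegral_indicator measurableSet_Icc, Set.inter_eq_right.2]
    exact fun t ht => lt_of_lt_of_le ha ht.1
  rw [e2, ← integral_comp_rpow_Ioi_of_pos (g := (Set.Icc a b).indicator (chiSqPDF m)) (p := 2) (by norm_num)]
  simp only [finrank_euclideanSpace, Fintype.card_fin, measureReal_def,
    EuclideanSpace.volume_ball, ENNReal.ofReal_one, one_pow, one_mul, nsmul_eq_mul, smul_eq_mul]
  rw [ENNReal.toReal_ofReal (by
    have : 0 < Real.Gamma ((m : ℝ) / 2 + 1) := Real.Gamma_pos_of_pos (by positivity)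
    positivity), ← integral_const_mul, ← integral_const_mul]
  refine setIntegral_congr_fun measurableSet_Ioi fun r hr => ?_
  have hr : 0 < r := hr
  have e3 : r ^ (2 : ℝ) = r ^ 2 := by exact_mod_cast Real.rpow_natCast r 2
  have e4 : r ^ ((2 : ℝ) - 1) = r := by norm_num
  simp only [hf, e3, e4]
  by_cases h : r ^ 2 ∈ Set.Icc a b
  · simp only [Set.indicator_of_mem h]
    exact chi_const m hm r hr
  · simp [Set.indicator_of_notMem h]

lemma band_std (m : ℕ) (a b : ℝ) :
    (Measure.pi fun _ : Fin (m + 1) => gaussianReal 0 1)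
      {x : Fin (m + 1) → ℝ |
        a ≤ ∑ k, (x k - (∑ j, x j) / (m + 1 : ℝ)) ^ 2 ∧
        ∑ k, (x k - (∑ j, x j) / (m + 1 : ℝ)) ^ 2 ≤ b} =
    (Measure.pi fun _ : Fin m => gaussianReal 0 1)
      {y : Fin m → ℝ | a ≤ ∑ i, y i ^ 2 ∧ ∑ i, y i ^ 2 ≤ b} := by
  have hn : (0 : ℝ) < m + 1 := by positivity
  have hs : 0 < √((m : ℝ) + 1) := Real.sqrt_pos.2 hn
  have hss : √((m : ℝ) + 1) ^ 2 = m + 1 := Real.sq_sqrt hn.le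
  let u : EuclideanSpace ℝ (Fin (m + 1)) := WithLp.toLp 2 fun _ => (√((m : ℝ) + 1))⁻¹
  have hu : ‖u‖ = 1 := by
    rw [← sq_eq_sq₀ (norm_nonneg _) zero_le_one, EuclideanSpace.real_norm_sq_eq]
    simp only [u, inv_pow, hss]
    simp
    field_simp
  obtain ⟨B, hB⟩ := Orthonormal.exists_orthonormalBasis_extension_of_card_eq (𝕜 := ℝ)
    (E := EuclideanSpace ℝ (Fin (m + 1))) (ι := Fin (m + 1)) (by simp)
    (v := fun _ => u) (s := {0}) (by
      refine ⟨fun i => hu, fun i j hij => ?_⟩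
      exact absurd (Subsingleton.elim i j) hij)
  have hB0 : B 0 = u := hB 0 rfl
  -- algebraic identity
  have key : ∀ z : EuclideanSpace ℝ (Fin (m + 1)),
      ∑ k, (z k - (∑ j, z j) / (m + 1 : ℝ)) ^ 2 = ∑ i : Fin m, (inner ℝ (B i.succ) z) ^ 2 := by
    intro z
    have h1 := B.sum_sq_inner_right z
    rw [Fin.sum_univ_succ, hB0, EuclideanSpace.real_norm_sq_eq] at h1
    have h2 : inner ℝ u z = (√((m : ℝ) + 1))⁻¹ * ∑ j, z j := by
      rw [PiLp.inner_apply, Finset.mul_sum]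
      refine Finset.sum_congr rfl fun j _ => ?_
      simp [u, mul_comm]
    rw [h2, mul_pow, inv_pow, hss] at h1
    have h3 : ∑ k, (z k - (∑ j, z j) / (m + 1 : ℝ)) ^ 2 =
        ∑ k, z k ^ 2 - (m + 1 : ℝ)⁻¹ * (∑ j, z j) ^ 2 := by
      simp only [sub_sq, Finset.sum_add_distrib, Finset.sum_sub_distrib, ← Finset.sum_mul,
        ← Finset.mul_sum, Finset.sum_const, Finset.card_univ, Fintype.card_fin, nsmul_eq_mul]
      push_cast
      field_simp
      ring
    rw [h3]
    linarith
  let T : Set (EuclideanSpace ℝ (Fin (m + 1))) :=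
    {z | ∑ k, (z k - (∑ j, z j) / (m + 1 : ℝ)) ^ 2 ∈ Set.Icc a b}
  have hT : MeasurableSet T := by
    have : Measurable fun z : EuclideanSpace ℝ (Fin (m + 1)) =>
      ∑ k, (z k - (∑ j, z j) / (m + 1 : ℝ)) ^ 2 := by fun_prop
    exact this measurableSet_Icc
  have hU : MeasurableSet {y : Fin m → ℝ | a ≤ ∑ i, y i ^ 2 ∧ ∑ i, y i ^ 2 ≤ b} := by
    have : Measurable fun y : Fin m → ℝ => ∑ i, y i ^ 2 := by fun_prop
    exact this measurableSet_Icc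
  have s1 : (Measure.pi fun _ : Fin (m + 1) => gaussianReal 0 1)
      {x : Fin (m + 1) → ℝ |
        a ≤ ∑ k, (x k - (∑ j, x j) / (m + 1 : ℝ)) ^ 2 ∧
        ∑ k, (x k - (∑ j, x j) / (m + 1 : ℝ)) ^ 2 ≤ b} =
      stdGaussian (EuclideanSpace ℝ (Fin (m + 1))) T := by
    rw [← map_pi_eq_stdGaussian, Measure.map_apply (by fun_prop) hT]
    rfl
  rw [s1, stdGaussian_eq_map_pi_orthonormalBasis B, Measure.map_apply (by fun_prop) hT]
  have mp := (measurePreserving_snd (μ := gaussianReal 0 1)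
    (ν := Measure.pi fun _ : Fin m => gaussianReal 0 1)).comp
    (measurePreserving_piFinSuccAbove (fun _ : Fin (m + 1) => gaussianReal 0 1) 0)
  rw [← mp.measure_preimage hU.nullMeasurableSet]
  congr 1
  ext x
  have : ∀ i, inner ℝ (B i) (∑ j, x j • B j) = x i := fun i => by
    simpa using B.orthonormal.inner_right_fintype x i
  simp only [T, Set.mem_preimage, Set.mem_ofPred_eq, key, this]
  simp [MeasurableEquiv.piFinSuccAbove, Fin.insertNthEquiv, Fin.tail]

/-- the probability that `S̄(x)/n` lies in
`[σ²e^{-2η}, σ²e^{2η}]` is a chi-squared integral depending only on `n, η`. -/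
theorem sample_variance_band_prob
    (n : ℕ) (hn : 2 ≤ n) (μ σ η : ℝ) (hσ : 0 < σ) (hη : 0 < η) :
    (Measure.pi fun _ : Fin n => gaussianReal μ (Real.toNNReal (σ ^ 2)))
        {x : Fin n → ℝ |
          σ ^ 2 * Real.exp (-2 * η) ≤ (∑ k, (x k - (∑ j, x j) / n) ^ 2) / n ∧
          (∑ k, (x k - (∑ j, x j) / n) ^ 2) / n ≤ σ ^ 2 * Real.exp (2 * η)}
      = ENNReal.ofReal
          (∫ t in (n * Real.exp (-2 * η))..(n * Real.exp (2 * η)),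
            chiSqPDF (n - 1) t) := by

  obtain ⟨m, rfl⟩ : ∃ m, n = m + 1 := ⟨n - 1, by omega⟩
  have hn : (0 : ℝ) < m + 1 := by positivity
  rw [Nat.add_sub_cancel, ← chi_band m (by omega) _ _ (by positivity) (by
    have : Real.exp (-2 * η) ≤ Real.exp (2 * η) := Real.exp_le_exp.2 (by linarith)
    gcongr)]
  push_cast
  rw [← band_std]
  have hmap : (gaussianReal 0 1).map (fun t => μ + σ * t) =
      gaussianReal μ (Real.toNNReal (σ ^ 2)) := by
    have : (fun t : ℝ => μ + σ * t) = (fun t => μ + t) ∘ (fun t => σ * t) := rfl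
    rw [this, ← Measure.map_map (by fun_prop) (by fun_prop), gaussianReal_map_const_mul,
      gaussianReal_map_const_add]
    congr 1
    · simp
    · ext; simp [sq_nonneg]
  have hpi : (Measure.pi fun _ : Fin (m + 1) => gaussianReal μ (Real.toNNReal (σ ^ 2))) =
      (Measure.pi fun _ : Fin (m + 1) => gaussianReal 0 1).map
        (fun x i => μ + σ * x i) := by
    have : SigmaFinite ((gaussianReal 0 1).map (fun t => μ + σ * t)) := by
      rw [hmap]; infer_instance
    rw [Measure.pi_map_pi (f := fun _ t => μ + σ * t) (fun i => by fun_prop), hmap]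
  rw [hpi, Measure.map_apply (by fun_prop)]
  · congr 1
    ext x
    have h : ∑ k, (μ + σ * x k - (∑ j, (μ + σ * x j)) / (m + 1 : ℝ)) ^ 2 =
        σ ^ 2 * ∑ k, (x k - (∑ j, x j) / (m + 1 : ℝ)) ^ 2 := by
      rw [Finset.mul_sum]
      refine Finset.sum_congr rfl fun k _ => ?_
      rw [Finset.sum_add_distrib, ← Finset.mul_sum, ← mul_pow]
      simp only [Finset.sum_const, Finset.card_univ, Fintype.card_fin, nsmul_eq_mul]
      push_cast
      congr 1
      field_simp
      ring
    simp only [Set.mem_preimage, Set.mem_ofPred_eq, h]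
    rw [mul_div_assoc, mul_le_mul_iff_right₀ (by positivity),
      mul_le_mul_iff_right₀ (by positivity), le_div_iff₀ hn, div_le_iff₀ hn, mul_comm,
      mul_comm (Real.exp (2 * η))]
  · have : Measurable fun x : Fin (m + 1) → ℝ =>
        (∑ k, (x k - (∑ j, x j) / (m + 1 : ℝ)) ^ 2) / (m + 1 : ℝ) := by fun_prop
    exact this measurableSet_Icc
end

section
/- Let n ≥ 2 and γ ∈ (0,1), and let t > 0 satisfy ∫_{−t}^{t} p^t_{n−1}(x) dx = γ. Then for every μ ∈ ℝ and σ > 0, N^n_{(μ,σ)}({x ∈ ℝⁿ : μ̄(x) − (σ̄'(x)/√n)·t ≤ μ ≤ μ̄(x) + (σ̄'(x)/√n)·t}) = γ, where σ̄'(x) = √(S̄(x)/(n−1)). -/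
open MeasureTheory ProbabilityTheory

/-- Student's t-density with `m` degrees of freedom. -/
noncomputable def tPDF (m : ℕ) (x : ℝ) : ℝ :=
  Real.Gamma (((m : ℝ) + 1) / 2) /
      (Real.sqrt (m * Real.pi) * Real.Gamma ((m : ℝ) / 2)) *
    (1 + x ^ 2 / m) ^ (-((m : ℝ) + 1) / 2)


lemma st_pi_density (m : ℕ) :
    (Measure.pi fun _ : Fin m => gaussianReal 0 1) =
      (volume : Measure (Fin m → ℝ)).withDensity (fun x => ENNReal.ofReal
        (((√(2 * Real.pi))⁻¹) ^ m * Real.exp (-(1/2) * ∑ i, x i ^ 2))) := by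
  have hF : ∀ x : Fin m → ℝ, ((√(2 * Real.pi))⁻¹) ^ m * Real.exp (-(1/2) * ∑ i, x i ^ 2)
      = ∏ i, gaussianPDFReal 0 1 (x i) := by
    intro x
    simp only [gaussianPDFReal, Finset.prod_mul_distrib, ← Real.exp_sum]
    simp only [NNReal.coe_one, mul_one, Finset.prod_const, Finset.card_univ, Fintype.card_fin,
      sub_zero, Finset.mul_sum]
    congr 3
    ext i
    ring
  simp_rw [hF]
  refine (Measure.pi_eq fun s hs => ?_)
  rw [withDensity_apply _ (MeasurableSet.univ_pi hs), volume_pi, Measure.restrict_pi_pi,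
    ← ofReal_integral_eq_lintegral_ofReal]
  · rw [integral_fintype_prod_eq_prod (fun _ => gaussianPDFReal 0 1),
      ENNReal.ofReal_prod_of_nonneg]
    · refine Finset.prod_congr rfl fun i _ => ?_
      rw [gaussianReal_apply_eq_integral _ one_ne_zero]
    · intro i _
      exact integral_nonneg (gaussianPDFReal_nonneg 0 1)
  · exact Integrable.fintype_prod (f := fun _ => gaussianPDFReal 0 1)
      (fun i => (integrable_gaussianPDFReal 0 1).integrableOn)
  · exact ae_of_all _ fun x => Finset.prod_nonneg fun i _ => gaussianPDFReal_nonneg 0 1 _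

/-- surface constant -/
noncomputable def stK (m : ℕ) : ℝ :=
  m * (volume : Measure (EuclideanSpace ℝ (Fin m))).real (Metric.ball 0 1)

lemma stK_nonneg (m : ℕ) : 0 ≤ stK m := by unfold stK; positivity

lemma st_radial (m : ℕ) (hm : 1 ≤ m) (q : ℕ) (b : ℝ) (hb : 0 < b) :
    ∫⁻ x : Fin m → ℝ, ENNReal.ofReal ((√(∑ i, x i ^ 2)) ^ q * Real.exp (-b * ∑ i, x i ^ 2)) =
      ENNReal.ofReal (stK m *
        (b ^ (-((m : ℝ) + q) / 2) * (1 / 2) * Real.Gamma (((m : ℝ) + q) / 2))) := by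
  have hne : Nonempty (Fin m) := ⟨⟨0, hm⟩⟩
  have h1 : ∀ x : EuclideanSpace ℝ (Fin m), (√(∑ i, x i ^ 2)) ^ q * Real.exp (-b * ∑ i, x i ^ 2)
      = (fun r : ℝ => r ^ q * Real.exp (-b * r ^ 2)) ‖x‖ := by
    intro x
    have : ‖x‖ = √(∑ i, x i ^ 2) := by simp [EuclideanSpace.norm_eq]
    simp only [this]
    rw [Real.sq_sqrt (by positivity)]
  have hfun : Set.EqOn (fun r : ℝ => r ^ (m - 1) • (r ^ q * Real.exp (-b * r ^ 2)))
      (fun r : ℝ => r ^ ((m : ℝ) + q - 1) * Real.exp (-b * r ^ (2:ℝ))) (Set.Ioi 0) := by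
    intro r hr
    have hr : 0 < r := hr
    have : (r : ℝ) ^ ((m : ℝ) + q - 1) = r ^ (m - 1) * r ^ q := by
      rw [← pow_add, ← Real.rpow_natCast]
      congr 1
      push_cast [Nat.cast_sub hm]
      ring
    simp only [this, smul_eq_mul, Real.rpow_two]
    ring
  have hm' : (1:ℝ) ≤ m := by exact_mod_cast hm
  have hq' : (0:ℝ) ≤ q := by positivity
  rw [← (PiLp.volume_preserving_toLp (Fin m)).symm (MeasurableEquiv.toLp 2 (Fin m → ℝ))
    |>.lintegral_comp_emb (MeasurableEquiv.measurableEmbedding _)]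
  simp only [MeasurableEquiv.coe_toLp_symm]
  simp_rw [h1]
  rw [← ofReal_integral_eq_lintegral_ofReal]
  · refine congrArg ENNReal.ofReal ((integral_fun_norm_addHaar
      (volume : Measure (EuclideanSpace ℝ (Fin m)))
      (fun r : ℝ => r ^ q * Real.exp (-b * r ^ 2))).trans ?_)
    simp only [finrank_euclideanSpace, Fintype.card_fin]
    rw [setIntegral_congr_fun measurableSet_Ioi hfun,
      integral_rpow_mul_exp_neg_mul_rpow two_pos (by linarith) hb]
    simp only [stK, nsmul_eq_mul, smul_eq_mul]
    ring_nf
  · refine (integrable_fun_norm_addHaar (volume : Measure (EuclideanSpace ℝ (Fin m)))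
      (f := fun r : ℝ => r ^ q * Real.exp (-b * r ^ 2))).2 ?_
    simp only [finrank_euclideanSpace, Fintype.card_fin]
    rw [integrableOn_congr_fun hfun measurableSet_Ioi]
    exact integrableOn_rpow_mul_exp_neg_mul_rpow (by linarith) two_pos hb
  · exact ae_of_all _ fun x => by positivity

lemma st_norm (m : ℕ) (hm : 1 ≤ m) :
    ((√(2 * Real.pi))⁻¹) ^ m * (stK m *
        ((1/2) ^ (-(m : ℝ) / 2) * (1 / 2) * Real.Gamma ((m : ℝ) / 2))) = 1 := by
  have h : (Measure.pi fun _ : Fin m => gaussianReal 0 1) Set.univ = 1 := measure_univ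
  rw [st_pi_density, withDensity_apply _ MeasurableSet.univ, setLIntegral_univ] at h
  have h2 := st_radial m hm 0 (1/2) (by norm_num)
  simp only [pow_zero, one_mul, CharP.cast_eq_zero, add_zero] at h2
  simp_rw [ENNReal.ofReal_mul (show 0 ≤ ((√(2 * Real.pi))⁻¹) ^ m by positivity)] at h
  rw [lintegral_const_mul' _ _ ENNReal.ofReal_ne_top, h2,
    ← ENNReal.ofReal_mul (by positivity)] at h
  exact ENNReal.ofReal_eq_one.mp h

lemma st_inner (m : ℕ) (hm : 1 ≤ m) (s : ℝ) :
    ∫⁻ w, ENNReal.ofReal (√(∑ i, w i ^ 2) / √m *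
        ((√(2 * Real.pi))⁻¹ * Real.exp (-(1/2) * (s * (√(∑ i, w i ^ 2) / √m)) ^ 2)))
      ∂(Measure.pi fun _ : Fin m => gaussianReal 0 1) = ENNReal.ofReal (tPDF m s) := by
  have hm' : (0:ℝ) < m := by exact_mod_cast hm
  set c := (√(2 * Real.pi))⁻¹ with hc
  have hc0 : 0 < c := by positivity
  set a := 1 + s ^ 2 / m with ha
  have ha0 : 0 < a := by positivity
  rw [st_pi_density, lintegral_withDensity_eq_lintegral_mul _ (by fun_prop) (by fun_prop)]
  have h1 : ∀ w : Fin m → ℝ, ((fun x : Fin m → ℝ => ENNReal.ofReal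
        (((√(2 * Real.pi))⁻¹) ^ m * Real.exp (-(1/2) * ∑ i, x i ^ 2))) *
       (fun w : Fin m → ℝ => ENNReal.ofReal (√(∑ i, w i ^ 2) / √m *
        (c * Real.exp (-(1/2) * (s * (√(∑ i, w i ^ 2) / √m)) ^ 2))))) w =
      ENNReal.ofReal (c ^ m * c / √m) * ENNReal.ofReal ((√(∑ i, w i ^ 2)) ^ 1 *
        Real.exp (-(a / 2) * ∑ i, w i ^ 2)) := by
    intro w
    rw [Pi.mul_apply, ← ENNReal.ofReal_mul (by positivity), ← ENNReal.ofReal_mul (by positivity)]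
    congr 1
    have : Real.exp (-(a / 2) * ∑ i, w i ^ 2) = Real.exp (-(1/2) * ∑ i, w i ^ 2) *
        Real.exp (-(1/2) * (s * (√(∑ i, w i ^ 2) / √m)) ^ 2) := by
      rw [← Real.exp_add, mul_pow, div_pow, Real.sq_sqrt (by positivity), Real.sq_sqrt hm'.le]
      congr 1
      rw [ha]
      ring
    rw [this]
    ring
  simp_rw [h1]
  rw [lintegral_const_mul' _ _ ENNReal.ofReal_ne_top, st_radial m hm 1 (a/2) (by positivity),
    ← ENNReal.ofReal_mul (by positivity)]
  congr 1
  have hn := st_norm m hm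
  rw [← hc] at hn
  have hG : 0 < Real.Gamma ((m : ℝ) / 2) := Real.Gamma_pos_of_pos (by positivity)
  have hcK : c ^ m * stK m = 2 / ((1/2) ^ (-(m : ℝ) / 2) * Real.Gamma ((m : ℝ) / 2)) := by
    have : (0:ℝ) < (1/2) ^ (-(m : ℝ) / 2) := by positivity
    field_simp at hn ⊢
    linarith
  have h2 : c ^ m * c / √m * (stK m * ((a/2) ^ (-((m : ℝ) + (1:ℕ)) / 2) * (1 / 2) *
      Real.Gamma (((m : ℝ) + (1:ℕ)) / 2))) = (c ^ m * stK m) * (c / √m * ((a/2) ^ (-((m : ℝ) + 1) / 2) * (1 / 2) *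
      Real.Gamma (((m : ℝ) + 1) / 2))) := by
    push_cast; ring
  rw [h2, hcK, tPDF, ← ha]
  have h3 : (a/2) ^ (-((m : ℝ) + 1) / 2) = a ^ (-((m : ℝ) + 1) / 2) *
      ((1/2) ^ (-(m : ℝ) / 2) * √2) := by
    rw [div_eq_mul_one_div a 2, Real.mul_rpow ha0.le (by norm_num)]
    congr 1
    rw [show (-((m : ℝ) + 1) / 2) = -(m : ℝ) / 2 + -(1/2) by ring,
      Real.rpow_add (by norm_num), Real.rpow_neg (by norm_num) (1/2), ← Real.sqrt_eq_rpow]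
    congr 1
    rw [one_div, Real.sqrt_inv, inv_inv]
  rw [h3, hc, Real.sqrt_mul (by norm_num), Real.sqrt_mul hm'.le]
  have : (0:ℝ) < (1/2) ^ (-(m : ℝ) / 2) := by positivity
  have : 0 < √Real.pi := by positivity
  have : 0 < √(m:ℝ) := by positivity
  field_simp

lemma tPDF_nonneg (m : ℕ) (s : ℝ) : 0 ≤ tPDF m s := by
  unfold tPDF
  have h1 : 0 < Real.Gamma (((m : ℝ) + 1) / 2) := Real.Gamma_pos_of_pos (by positivity)
  have h2 : 0 ≤ Real.Gamma ((m : ℝ) / 2) := Real.Gamma_nonneg_of_nonneg (by positivity)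
  positivity

lemma tPDF_continuous (m : ℕ) : Continuous (tPDF m) := by
  unfold tPDF
  refine Continuous.mul continuous_const (Continuous.rpow_const (by fun_prop) fun x => Or.inl ?_)
  positivity

lemma st_slice (t ρ : ℝ) (ht : 0 < t) (hρ : 0 ≤ ρ) :
    gaussianReal 0 1 {y : ℝ | |y| ≤ t * ρ} = ∫⁻ s in Set.Icc (-t) t,
      ENNReal.ofReal (ρ * ((√(2 * Real.pi))⁻¹ * Real.exp (-(1/2) * (s * ρ) ^ 2))) := by
  rcases hρ.eq_or_lt with h | h
  · subst h
    have : {y : ℝ | |y| ≤ t * 0} = {0} := by ext y; simp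
    rw [this]
    have := nullSingletonClass_gaussianReal (μ := 0) (v := 1) one_ne_zero
    simp
  · have hset : {y : ℝ | |y| ≤ t * ρ} = (fun s => s * ρ) '' Set.Icc (-t) t := by
      rw [Set.image_mul_right_Icc (by linarith) h.le]
      ext y
      simp [abs_le]
    rw [hset, gaussianReal_apply _ one_ne_zero,
      lintegral_image_eq_lintegral_abs_deriv_mul (f' := fun _ => ρ) measurableSet_Icc
        (fun x _ => (hasDerivAt_mul_const ρ).hasDerivWithinAt)
        (fun x _ y _ hxy => mul_right_cancel₀ h.ne' hxy)]
    refine lintegral_congr fun s => ?_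
    rw [abs_of_pos h, gaussianPDF, ← ENNReal.ofReal_mul h.le, gaussianPDFReal]
    congr 4
    · simp
    · simp; ring

lemma st_prod (m : ℕ) (hm : 1 ≤ m) (t : ℝ) (ht : 0 < t) :
    ((gaussianReal 0 1).prod (Measure.pi fun _ : Fin m => gaussianReal 0 1))
      {p | |p.1| ≤ t * (√(∑ i, p.2 i ^ 2) / √m)} =
    ENNReal.ofReal (∫ s in (-t)..t, tPDF m s) := by
  rw [Measure.prod_apply_symm (measurableSet_le (by fun_prop) (by fun_prop))]
  have h1 : ∀ w : Fin m → ℝ, gaussianReal 0 1 ((fun x => (x, w)) ⁻¹'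
      {p : ℝ × (Fin m → ℝ) | |p.1| ≤ t * (√(∑ i, p.2 i ^ 2) / √m)}) = _ :=
    fun w => st_slice t (√(∑ i, w i ^ 2) / √m) ht (by positivity)
  simp_rw [h1]
  rw [lintegral_lintegral_swap (by fun_prop)]
  simp_rw [st_inner m hm]
  rw [intervalIntegral.integral_of_le (by linarith), ← integral_Icc_eq_integral_Ioc,
    ofReal_integral_eq_lintegral_ofReal]
  · exact (tPDF_continuous m).continuousOn.integrableOn_Icc
  · exact ae_of_all _ (tPDF_nonneg m)

lemma st_rot (m : ℕ) : ∃ b : OrthonormalBasis (Fin (m + 1)) ℝ (EuclideanSpace ℝ (Fin (m + 1))),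
    ∀ j, b 0 j = (√((m : ℝ) + 1))⁻¹ := by
  have hm : (0:ℝ) < m + 1 := by positivity
  let v : Fin (m + 1) → EuclideanSpace ℝ (Fin (m + 1)) :=
    fun _ => WithLp.toLp 2 (fun _ => (√((m : ℝ) + 1))⁻¹)
  have hv : Orthonormal ℝ (({0} : Set (Fin (m + 1))).domRestrict v) := by
    refine ⟨?_, ?_⟩
    · rintro ⟨i, hi⟩
      have : ((m:ℝ) + 1) * (√((m : ℝ) + 1) ^ 2)⁻¹ = 1 := by
        rw [Real.sq_sqrt hm.le]; field_simp
      change ‖v i‖ = 1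
      simp [v, EuclideanSpace.norm_eq, this]
    · rintro ⟨i, hi⟩ ⟨j, hj⟩ hij
      exact absurd (Subtype.ext (hi.trans hj.symm)) hij
  obtain ⟨b, hb⟩ := hv.exists_orthonormalBasis_extension_of_card_eq (by simp)
  refine ⟨b, fun j => ?_⟩
  rw [hb 0 rfl]

lemma st_std (m : ℕ) (hm : 1 ≤ m) (t : ℝ) (ht : 0 < t) :
    (Measure.pi fun _ : Fin (m + 1) => gaussianReal 0 1)
      {z | |√((m : ℝ) + 1) * ((∑ k, z k) / ((m : ℝ) + 1))| ≤
        t * (√(∑ k, (z k - (∑ j, z j) / ((m : ℝ) + 1)) ^ 2) / √m)} =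
    ENNReal.ofReal (∫ s in (-t)..t, tPDF m s) := by
  have hm1 : (0:ℝ) < m + 1 := by positivity
  obtain ⟨b, hb⟩ := st_rot m
  have hmeas : Measurable (fun y : Fin (m + 1) → ℝ => ∑ i, y i • b i) := by fun_prop
  have hmap : (Measure.pi fun _ : Fin (m + 1) => gaussianReal 0 1) =
      (Measure.pi fun _ : Fin (m + 1) => gaussianReal 0 1).map
        (fun y => WithLp.ofLp (∑ i, y i • b i)) := by
    have h1 := stdGaussian_eq_map_pi_orthonormalBasis b
    rw [← map_pi_eq_stdGaussian] at h1
    have h2 := congrArg (Measure.map (WithLp.ofLp (p := 2) (V := Fin (m + 1) → ℝ))) h1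
    rw [Measure.map_map (by fun_prop) (by fun_prop), Measure.map_map (by fun_prop) hmeas] at h2
    refine Eq.trans ?_ h2
    exact Measure.map_id.symm
  rw [hmap, Measure.map_apply (by fun_prop) (measurableSet_le (by fun_prop) (by fun_prop)),
    ← st_prod m hm t ht]
  rw [← (measurePreserving_piFinSuccAbove (fun _ : Fin (m + 1) => gaussianReal 0 1) 0).measure_preimage
    (measurableSet_le (by fun_prop) (by fun_prop)).nullMeasurableSet]
  congr 1
  ext y
  simp only [Set.mem_preimage, Set.mem_ofPred_eq]
  set x := ∑ i, y i • b i with hx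
  have hx' : x = b.repr.symm (WithLp.toLp 2 y) := b.sum_repr_symm (WithLp.toLp 2 y)
  have hs : ∑ k, x k = √((m : ℝ) + 1) * y 0 := by
    have h1 : inner ℝ (b 0) x = y 0 := by
      rw [← b.repr_apply_apply, hx']
      simp
    rw [← h1, PiLp.inner_apply]
    simp only [hb]
    simp [← Finset.sum_mul]
    field_simp
  have hn : ∑ k, x k ^ 2 = ∑ i, y i ^ 2 := by
    have h1 : ‖x‖ ^ 2 = ∑ i, y i ^ 2 := by
      rw [hx', LinearIsometryEquiv.norm_map]
      simp [EuclideanSpace.norm_sq_eq]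
    rw [← h1]
    simp [EuclideanSpace.norm_sq_eq]
  have hS : ∑ k, (x k - (∑ j, x j) / ((m : ℝ) + 1)) ^ 2 = ∑ i : Fin m, y i.succ ^ 2 := by
    simp only [sub_sq, Finset.sum_add_distrib, Finset.sum_sub_distrib, hn, ← Finset.sum_mul,
      ← Finset.mul_sum, hs]
    rw [Fin.sum_univ_succ]
    simp only [div_pow, mul_pow, Real.sq_sqrt hm1.le, Finset.sum_const, Finset.card_univ,
      Fintype.card_fin, nsmul_eq_mul]
    push_cast
    have := Real.sq_sqrt hm1.le
    field_simp
    rw [this]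
    ring
  rw [hS, hs]
  have : √((m : ℝ) + 1) * (√((m : ℝ) + 1) * y 0 / ((m : ℝ) + 1)) = y 0 := by
    rw [mul_div_assoc', ← mul_assoc, Real.mul_self_sqrt hm1.le]
    field_simp
  rw [this]
  rfl

/-- exact coverage of the Student t `γ`-confidence interval
for the mean `μ` when `σ` is unknown. -/
theorem confidence_interval_student_t
    (n : ℕ) (hn : 2 ≤ n) (γ : ℝ) (hγ : γ ∈ Set.Ioo (0 : ℝ) 1)
    (t : ℝ) (ht : 0 < t)
    (htγ : ∫ s in (-t)..t, tPDF (n - 1) s = γ) :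
    ∀ (μ σ : ℝ), 0 < σ →
      (Measure.pi fun _ : Fin n => gaussianReal μ (Real.toNNReal (σ ^ 2)))
          {x : Fin n → ℝ |
            (∑ k, x k) / n -
              Real.sqrt ((∑ k, (x k - (∑ j, x j) / n) ^ 2) / (n - 1)) /
                Real.sqrt n * t ≤ μ ∧
            μ ≤ (∑ k, x k) / n +
              Real.sqrt ((∑ k, (x k - (∑ j, x j) / n) ^ 2) / (n - 1)) /
                Real.sqrt n * t}
        = ENNReal.ofReal γ := by
  intro μ σ hσ
  obtain ⟨m, rfl⟩ : ∃ m, n = m + 1 := ⟨n - 1, by omega⟩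
  have hm : 1 ≤ m := by omega
  simp only [Nat.add_sub_cancel] at htγ
  have hm0 : (0:ℝ) < m := by exact_mod_cast hm
  have hm1 : (0:ℝ) < m + 1 := by positivity
  have hmap : (Measure.pi fun _ : Fin (m + 1) => gaussianReal μ (Real.toNNReal (σ ^ 2))) =
      (Measure.pi fun _ : Fin (m + 1) => gaussianReal 0 1).map (fun z i => μ + σ * z i) := by
    rw [Measure.pi_map_pi (f := fun _ z => μ + σ * z) (fun i => by fun_prop)]
    congr 1
    ext1 i
    have : (fun z : ℝ => μ + σ * z) = (fun z => μ + z) ∘ (fun z => σ * z) := rfl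
    rw [this, ← Measure.map_map (by fun_prop) (by fun_prop), gaussianReal_map_const_mul,
      gaussianReal_map_const_add]
    congr 1
    · simp
    · ext; simp [Real.coe_toNNReal _ (sq_nonneg σ)]
  rw [← htγ, ← st_std m hm t ht, hmap, Measure.map_apply (by fun_prop)]
  · congr 1
    ext z
    simp only [Set.mem_preimage, Set.mem_ofPred_eq]
    push_cast
    have h1 : (∑ k, (μ + σ * z k)) / ((m : ℝ) + 1) = μ + σ * ((∑ k, z k) / ((m : ℝ) + 1)) := by
      rw [Finset.sum_add_distrib, ← Finset.mul_sum]
      simp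
      field_simp
    have h2 : ∑ k, (μ + σ * z k - (μ + σ * ((∑ k, z k) / ((m : ℝ) + 1)))) ^ 2 =
        σ ^ 2 * ∑ k, (z k - (∑ j, z j) / ((m : ℝ) + 1)) ^ 2 := by
      rw [Finset.mul_sum]
      refine Finset.sum_congr rfl fun k _ => ?_
      ring
    rw [h1, h2, show (m : ℝ) + 1 - 1 = m by ring, Real.sqrt_div' _ hm0.le,
      Real.sqrt_mul (sq_nonneg σ), Real.sqrt_sq hσ.le]
    set A := (∑ k, z k) / ((m : ℝ) + 1)
    set B := √(∑ k, (z k - A) ^ 2) / √(m : ℝ) with hB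
    have hr : 0 < √((m : ℝ) + 1) := by positivity
    set r := √((m : ℝ) + 1)
    have h3 : σ * √(∑ k, (z k - A) ^ 2) / √(m : ℝ) / r * t = σ * (t * B / r) := by
      rw [hB]; ring
    rw [h3, abs_mul, abs_of_pos hr, mul_comm r, ← le_div_iff₀ hr, abs_le]
    constructor
    · rintro ⟨h, h'⟩
      constructor
      · by_contra hc
        nlinarith
      · by_contra hc
        nlinarith
    · rintro ⟨h, h'⟩
      constructor <;> nlinarith
  · rw [Set.setOf_and]
    refine MeasurableSet.inter (measurableSet_le ?_ ?_) (measurableSet_le ?_ ?_) <;> fun_prop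
end
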